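/- For every n ≥ 1, every k with 0 ≤ k < n, and distinct atoms p, q, there exists a valuation v ∈ F_{C_n} such that v(p^k ∧ ¬(p^k)) ∈ D_n and v(q) = F_n. (This is the semantic counterpart of the paraconsistent part of the hierarchy: a contradiction of depth k < n does not entail an arbitrary formula in C_n.) -/

import Mathlib

/-- Formulas of the language of da Costa's calculi `Cₙ`. -/
inductive CnForm : Type where
  | atom : ℕ → CnForm
  | neg : CnForm → CnForm
  | conj : CnForm → CnForm → CnForm
  | disj : CnForm → CnForm → CnForm
  | imp : CnForm → CnForm → CnForm
deriving DecidableEq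

/-- Truth values of the Nmatrix `M_{Cₙ}`: `Tv` is `Tₙ`, `tv i` is `tᵢⁿ`, `Fv` is `Fₙ`. -/
inductive CnVal (n : ℕ) : Type where
  | Tv : CnVal n
  | tv : Fin n → CnVal n
  | Fv : CnVal n
deriving DecidableEq

/-- Multifunction for negation. -/
def CnNeg {n : ℕ} : CnVal n → Set (CnVal n)
  | CnVal.Tv => {CnVal.Fv}
  | CnVal.tv _ => {x | x ≠ CnVal.Fv}
  | CnVal.Fv => {CnVal.Tv}

/-- Multifunction for conjunction. -/
def CnConj {n : ℕ} (x y : CnVal n) : Set (CnVal n) :=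
  if x = CnVal.Fv ∨ y = CnVal.Fv then {CnVal.Fv}
  else if x = CnVal.Tv ∧ y = CnVal.Tv then {CnVal.Tv}
  else {z | z ≠ CnVal.Fv}

/-- Multifunction for disjunction. -/
def CnDisj {n : ℕ} (x y : CnVal n) : Set (CnVal n) :=
  if x = CnVal.Fv ∧ y = CnVal.Fv then {CnVal.Fv}
  else if (x = CnVal.Tv ∨ x = CnVal.Fv) ∧ (y = CnVal.Tv ∨ y = CnVal.Fv) ∧
          (x = CnVal.Tv ∨ y = CnVal.Tv) then {CnVal.Tv}
  else {z | z ≠ CnVal.Fv}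

/-- Multifunction for implication. -/
def CnImp {n : ℕ} (x y : CnVal n) : Set (CnVal n) :=
  if x ≠ CnVal.Fv ∧ y = CnVal.Fv then {CnVal.Fv}
  else if (x = CnVal.Fv ∧ (y = CnVal.Tv ∨ y = CnVal.Fv)) ∨ (x = CnVal.Tv ∧ y = CnVal.Tv)
    then {CnVal.Tv}
  else {z | z ≠ CnVal.Fv}

/-- `v ∈ Val(M_{Cₙ})`: `v` is a valuation of the Nmatrix `M_{Cₙ}`. -/
def CnIsVal {n : ℕ} (v : CnForm → CnVal n) : Prop :=
  (∀ a, v (CnForm.neg a) ∈ CnNeg (v a)) ∧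
  (∀ a b, v (CnForm.conj a b) ∈ CnConj (v a) (v b)) ∧
  (∀ a b, v (CnForm.disj a b) ∈ CnDisj (v a) (v b)) ∧
  (∀ a b, v (CnForm.imp a b) ∈ CnImp (v a) (v b))

/-- `a.pow k` is `αᵏ`: `α⁰ = α`, `α^{k+1} = ¬(αᵏ ∧ ¬αᵏ)`. -/
def CnForm.pow (a : CnForm) : ℕ → CnForm
  | 0 => a
  | k + 1 => CnForm.neg (CnForm.conj (a.pow k) (CnForm.neg (a.pow k)))

/-- `v ∈ F_{Cₙ}`: a valuation satisfying the restriction of the RNmatrix for `Cₙ`. -/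
def CnRestricted {n : ℕ} (v : CnForm → CnVal n) : Prop :=
  CnIsVal v ∧
  ∀ (a : CnForm) (i : Fin n), v a = CnVal.tv i →
    (i.val = 0 → v (CnForm.conj a (CnForm.neg a)) = CnVal.Tv) ∧
    (∀ j : Fin n, i.val = j.val + 1 →
      (∃ m : Fin n, v (CnForm.conj a (CnForm.neg a)) = CnVal.tv m) ∧
      v (a.pow 1) = CnVal.tv j)

/-- Tautology of the RNmatrix `R(M_{Cₙ}) = ⟨F_{Cₙ}, M_{Cₙ}⟩`. -/
def CnTaut (n : ℕ) (φ : CnForm) : Prop :=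
  ∀ v : CnForm → CnVal n, CnRestricted v → v φ ≠ CnVal.Fv

/-- The predecessor on truth values: `tᵢ₊₁` goes to `tᵢ` and every other value to `Tₙ`. -/
def CnVal.lower {n : ℕ} : CnVal n → CnVal n
  | CnVal.tv ⟨i + 1, h⟩ => CnVal.tv ⟨i, Nat.lt_of_succ_lt h⟩
  | _ => CnVal.Tv

theorem CnVal.lower_ne_Fv {n : ℕ} (x : CnVal n) : x.lower ≠ CnVal.Fv := by
  rcases x with _ | ⟨_ | i, h⟩ | _ <;> simp [CnVal.lower]

/-- A deterministic refinement of `M_{Cₙ}`, extended from an assignment of the atoms. -/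
def CnForm.eval {n : ℕ} (e : ℕ → CnVal n) : CnForm → CnVal n
  | atom r => e r
  | neg a =>
    match a.eval e with
    | CnVal.Tv => CnVal.Fv
    | CnVal.tv i => CnVal.tv i
    | CnVal.Fv => CnVal.Tv
  | conj a b =>
    if a.eval e = CnVal.Fv ∨ b.eval e = CnVal.Fv then CnVal.Fv else (a.eval e).lower
  | disj a b =>
    if a.eval e = CnVal.Fv ∧ b.eval e = CnVal.Fv then CnVal.Fv else CnVal.Tv
  | imp a b =>
    if a.eval e ≠ CnVal.Fv ∧ b.eval e = CnVal.Fv then CnVal.Fv else CnVal.Tv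

theorem CnForm.isVal_eval {n : ℕ} (e : ℕ → CnVal n) : CnIsVal (CnForm.eval e) := by
  refine ⟨fun a => ?_, fun a b => ?_, fun a b => ?_, fun a b => ?_⟩
  · cases h : a.eval e <;> simp [CnForm.eval, CnNeg, h]
  · have := (a.eval e).lower_ne_Fv
    simp only [CnForm.eval, CnConj]
    split_ifs with h₁ h₂
    · rfl
    · rw [h₂.1]; rfl
    · exact this
  · simp only [CnForm.eval, CnDisj]
    split_ifs <;> simp
  · simp only [CnForm.eval, CnImp]
    split_ifs <;> simp

theorem CnForm.eval_neg_of_tv {n : ℕ} {e : ℕ → CnVal n} {a : CnForm} {i : Fin n}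
    (h : a.eval e = CnVal.tv i) : a.neg.eval e = CnVal.tv i := by
  simp [CnForm.eval, h]

theorem CnForm.eval_contradiction_of_tv {n : ℕ} {e : ℕ → CnVal n} {a : CnForm} {i : Fin n}
    (h : a.eval e = CnVal.tv i) : (a.conj a.neg).eval e = (CnVal.tv i).lower := by
  simp [CnForm.eval, h]

theorem CnForm.restricted_eval {n : ℕ} (e : ℕ → CnVal n) : CnRestricted (CnForm.eval e) := by
  refine ⟨CnForm.isVal_eval e, fun a i h => ?_⟩
  have hc := CnForm.eval_contradiction_of_tv h
  obtain ⟨i, hi⟩ := i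
  refine ⟨?_, ?_⟩
  · rintro rfl
    exact hc
  · rintro ⟨j, hj⟩ rfl
    exact ⟨⟨_, hc⟩, CnForm.eval_neg_of_tv hc⟩

theorem CnForm.eval_pow {n : ℕ} {e : ℕ → CnVal n} {a : CnForm} {k : ℕ} (hk : k < n)
    (h : a.eval e = CnVal.tv ⟨k, hk⟩) (j : ℕ) (hj : j ≤ k) :
    (a.pow j).eval e = CnVal.tv ⟨k - j, by omega⟩ := by
  induction j with
  | zero => exact h
  | succ j ih =>
    exact (((CnForm.restricted_eval e).2 _ _ (ih (by omega))).2 ⟨k - (j + 1), by omega⟩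
      (by simp only; omega)).2

theorem low_depth_contradiction_does_not_explode (n : ℕ) (hn : 1 ≤ n)
    (k : ℕ) (hk : k < n) (p q : ℕ) (hpq : p ≠ q) :
    ∃ v : CnForm → CnVal n, CnRestricted v ∧
      v (CnForm.conj ((CnForm.atom p).pow k) (CnForm.neg ((CnForm.atom p).pow k))) ≠ CnVal.Fv ∧
      v (CnForm.atom q) = CnVal.Fv := by
  refine ⟨CnForm.eval fun r => if r = p then CnVal.tv ⟨k, hk⟩ else CnVal.Fv,
    CnForm.restricted_eval _, ?_, by simp [CnForm.eval, hpq.symm]⟩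
  rw [CnForm.eval_contradiction_of_tv
    (CnForm.eval_pow hk (by simp [CnForm.eval]) k le_rfl)]
  exact CnVal.lower_ne_Fv _
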